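/- Let K be a field of characteristic p ≥ 0 and let C be a finite cyclic group of order e with generator σ₀, where e is invertible in K and K contains a primitive e-th root of unity. Let α ∈ K* and consider the twisted group algebra K^α C ≅ K[x]/(x^e − α) (where U_{σ₀} ↦ x). Let d be the largest divisor of e such that α has a d-th root in K, and write e = cd. Then K[x]/(x^e − α) is a product of exactly d fields, each isomorphic to K[y]/(y^c − β) for suitable β ∈ K* such that y^c − β is irreducible; in particular the number of primitive idempotents of K^α C equals d. -/

import Mathlib

open Polynomial

/-- If `K` contains a primitive `n`-th root of unity and `a` is not a `p`-th power for any prime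
`p ∣ n`, then `X ^ n - C a` is irreducible. -/
theorem X_pow_sub_C_irreducible_of_isPrimitiveRoot {K : Type*} [Field K] {n : ℕ} (hn : n ≠ 0)
    {ζ : K} (hζ : IsPrimitiveRoot ζ n) {a : K} (ha : a ≠ 0)
    (h : ∀ p : ℕ, p.Prime → p ∣ n → ∀ b : K, b ^ p ≠ a) :
    Irreducible ((X : K[X]) ^ n - C a) := by
  have hmonic : ((X : K[X]) ^ n - C a).Monic := monic_X_pow_sub_C a hn
  have hdeg : ((X : K[X]) ^ n - C a).natDegree = n := natDegree_X_pow_sub_C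
  have hunit : ¬ IsUnit ((X : K[X]) ^ n - C a) :=
    not_isUnit_of_natDegree_pos _ (hdeg.symm ▸ Nat.pos_of_ne_zero hn)
  obtain ⟨f, hf, hfdvd⟩ := WfDvdMonoid.exists_irreducible_factor hunit hmonic.ne_zero
  suffices hdvd : n ∣ f.natDegree from
    (associated_of_dvd_of_natDegree_le hfdvd hmonic.ne_zero
      (hdeg.trans_le (Nat.le_of_dvd hf.natDegree_pos hdvd))).irreducible hf
  have : Fact (Irreducible f) := ⟨hf⟩
  -- The norm of a root `r` of `f` satisfies `N(r) ^ n = N(a) = a ^ deg f`.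
  have hroot : AdjoinRoot.root f ^ n = algebraMap K (AdjoinRoot f) a := by
    have hmk : AdjoinRoot.mk f (X ^ n - C a) = 0 := AdjoinRoot.mk_eq_zero.mpr hfdvd
    simpa [sub_eq_zero] using hmk
  have hnorm : Algebra.norm K (AdjoinRoot.root f) ^ n = a ^ f.natDegree := by
    rw [← map_pow, hroot, Algebra.norm_algebraMap,
      (AdjoinRoot.powerBasis hf.ne_zero).finrank, AdjoinRoot.powerBasis_dim]
  generalize Algebra.norm K (AdjoinRoot.root f) = b at hnorm
  by_contra hndvd
  have hgpos : 0 < n.gcd f.natDegree := Nat.gcd_pos_of_pos_left _ (Nat.pos_of_ne_zero hn)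
  obtain ⟨g, k, m, hg, hkm, hnk, hfm⟩ := Nat.exists_coprime' hgpos
  have hk : k ≠ 1 := by
    rintro rfl
    exact hndvd (hfm ▸ by simp [hnk])
  have hζk : IsPrimitiveRoot (ζ ^ k) g := hζ.pow (Nat.pos_of_ne_zero hn) hnk
  have : NeZero g := ⟨hg.ne'⟩
  have hquot : (b ^ k / a ^ m) ^ g = 1 := by
    rw [div_pow, ← pow_mul, ← pow_mul, ← hnk, ← hfm, hnorm, div_self (pow_ne_zero _ ha)]
  obtain ⟨i, -, hi⟩ := hζk.eq_pow_of_pow_eq_one hquot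
  have hζ0 : ζ ≠ 0 := hζ.ne_zero hn
  obtain ⟨y, hy⟩ := (pow_mem_range_pow_of_coprime hkm.symm a).mp
    ⟨b / ζ ^ i, by
      have ham := pow_ne_zero m ha
      have hζi := pow_ne_zero (k * i) hζ0
      rw [eq_div_iff ham] at hi
      simp only [div_pow, ← hi, ← pow_mul, mul_comm i k]
      field_simp⟩
  obtain ⟨p, hp, q, rfl⟩ := Nat.exists_prime_and_dvd hk
  refine h p hp (hnk ▸ Dvd.intro _ (mul_assoc p q g).symm) (y ^ q) ?_
  rw [← pow_mul, mul_comm q p]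
  exact hy

/-- If `a ≠ 0` has a `d`-th root `b`, then `X ^ (c * d) - C a` is the product of the polynomials
`X ^ c - C (ω ^ j * b)` for a primitive `d`-th root of unity `ω`. -/
theorem X_pow_mul_sub_C_eq_prod {R : Type*} [CommRing R] [IsDomain R] {c d : ℕ} (hd : 0 < d)
    {ω : R} (hω : IsPrimitiveRoot ω d) {a b : R} (hb : b ^ d = a) :
    (X : R[X]) ^ (c * d) - C a = ∏ j : Fin d, (X ^ c - C (ω ^ (j : ℕ) * b)) := by
  rw [Fin.prod_univ_eq_prod_range (fun j ↦ (X : R[X]) ^ c - C (ω ^ j * b)) d]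
  simpa [map_prod, ← pow_mul] using congrArg (expand R c) (X_pow_sub_C_eq_prod hω hd hb)

theorem isCoprime_X_pow_sub_C {K : Type*} [Field K] (n : ℕ) {a b : K} (hab : a ≠ b) :
    IsCoprime ((X : K[X]) ^ n - C a) (X ^ n - C b) := by
  simpa using (isCoprime_X_sub_C_of_isUnit_sub (sub_ne_zero.mpr hab).isUnit).map
    (expand K n : K[X] →+* K[X])

/-- **Chinese remainder theorem** for pairwise coprime elements, as an isomorphism of algebras. -/
theorem nonempty_quotient_span_prod_algEquiv_pi (K : Type*) {A ι : Type*} [CommRing K]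
    [CommRing A] [Algebra K A] [Fintype ι] (f : ι → A)
    (hf : Pairwise fun i j ↦ IsCoprime (f i) (f j)) :
    Nonempty ((A ⧸ Ideal.span {∏ i, f i}) ≃ₐ[K] ((i : ι) → A ⧸ Ideal.span {f i})) := by
  have hcop : Pairwise (Function.onFun IsCoprime fun i ↦ Ideal.span {f i}) :=
    fun i j hij ↦ (Ideal.isCoprime_span_singleton_iff _ _).mpr (hf hij)
  have hinf : ⨅ i, Ideal.span {f i} = Ideal.span {∏ i, f i} :=
    Ideal.iInf_span_singleton fun i j hij ↦ hf hij
  exact ⟨(Ideal.quotientEquivAlgOfEq K hinf.symm).trans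
    (AlgEquiv.ofRingEquiv (f := Ideal.quotientInfRingEquivPiQuotient _ hcop) fun _ ↦ rfl)⟩

/-- An idempotent is primitive if it is nonzero and not a sum of two nonzero orthogonal
idempotents. -/
def IsPrimitiveIdempotent {A : Type*} [Ring A] (x : A) : Prop :=
  x * x = x ∧ x ≠ 0 ∧ ∀ a b : A,
    a * a = a → b * b = b → a * b = 0 → b * a = 0 → x = a + b → a = 0 ∨ b = 0

theorem IsPrimitiveIdempotent.map {A B : Type*} [Ring A] [Ring B] (φ : A ≃+* B) {x : A}
    (hx : IsPrimitiveIdempotent x) : IsPrimitiveIdempotent (φ x) := by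
  obtain ⟨hxx, hx0, hx⟩ := hx
  refine ⟨by rw [← map_mul, hxx], by simpa using hx0, fun a b ha hb hab hba hsum ↦ ?_⟩
  have := hx (φ.symm a) (φ.symm b) (by rw [← map_mul, ha]) (by rw [← map_mul, hb])
    (by rw [← map_mul, hab, map_zero]) (by rw [← map_mul, hba, map_zero])
    (by rw [← map_add, ← hsum, φ.symm_apply_apply])
  simpa using this

theorem isPrimitiveIdempotent_map_iff {A B : Type*} [Ring A] [Ring B] (φ : A ≃+* B) {x : A} :
    IsPrimitiveIdempotent (φ x) ↔ IsPrimitiveIdempotent x :=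
  ⟨fun h ↦ by simpa using h.map φ.symm, fun h ↦ h.map φ⟩

/-- The primitive idempotents of a product of domains are the indicators of the factors. -/
theorem isPrimitiveIdempotent_pi_iff {ι : Type*} [DecidableEq ι] {F : ι → Type*}
    [∀ i, CommRing (F i)] [∀ i, IsDomain (F i)] {x : (i : ι) → F i} :
    IsPrimitiveIdempotent x ↔ ∃ i, Pi.single i 1 = x := by
  have idem {y : (i : ι) → F i} (hy : y * y = y) (i : ι) : y i = 0 ∨ y i = 1 :=
    IsIdempotentElem.iff_eq_zero_or_one.mp (congrFun hy i)
  constructor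
  · rintro ⟨hxx, hx0, hx⟩
    obtain ⟨i, hi⟩ := Function.ne_iff.mp hx0
    have hi1 : x i = 1 := (idem hxx i).resolve_left hi
    have hmul : x * Pi.single i 1 = Pi.single i 1 := by
      rw [← Pi.single_mul_right, hi1, one_mul]
    have hsq : (Pi.single i 1 : (i : ι) → F i) * Pi.single i 1 = Pi.single i 1 := by
      rw [← Pi.single_mul, one_mul]
    refine ⟨i, (sub_eq_zero.mp ((hx (Pi.single i 1) (x - Pi.single i 1) hsq ?_ ?_ ?_ ?_).resolve_left
      (by simp))).symm⟩
    · linear_combination hxx - 2 * hmul + hsq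
    · linear_combination hmul - hsq
    · linear_combination hmul - hsq
    · ring
  · rintro ⟨i, rfl⟩
    refine ⟨by rw [← Pi.single_mul, one_mul], by simp, fun a b ha hb hab _ hsum ↦ ?_⟩
    have hoff (j : ι) (hj : j ≠ i) : a j = 0 ∧ b j = 0 := by
      have hs : 0 = a j + b j := by simpa [hj] using congrFun hsum j
      have hm : a j * b j = 0 := congrFun hab j
      rcases mul_eq_zero.mp hm with h | h <;> simp_all
    have hm : a i * b i = 0 := congrFun hab i
    refine (mul_eq_zero.mp hm).imp (fun h ↦ funext fun j ↦ ?_) (fun h ↦ funext fun j ↦ ?_)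
    · by_cases hj : j = i
      · exact hj ▸ h
      · exact (hoff j hj).1
    · by_cases hj : j = i
      · exact hj ▸ h
      · exact (hoff j hj).2

theorem card_isPrimitiveIdempotent_of_ringEquiv_pi {A ι : Type*} [Ring A] {F : ι → Type*}
    [∀ i, CommRing (F i)] [∀ i, IsDomain (F i)] (φ : A ≃+* ((i : ι) → F i)) :
    Nat.card {x : A // IsPrimitiveIdempotent x} = Nat.card ι := by
  classical
  have hinj : Function.Injective fun i ↦ (Pi.single i 1 : (i : ι) → F i) := fun i j hij ↦ by
    by_contra hne
    simpa [hne] using congrFun hij i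
  refine Nat.card_congr ((φ.toEquiv.subtypeEquiv fun x ↦ ?_).trans (Equiv.ofInjective _ hinj).symm)
  exact (isPrimitiveIdempotent_map_iff φ).symm.trans isPrimitiveIdempotent_pi_iff

/-- Let `K` be a field, `C` cyclic of order `e` with `e` invertible
in `K` and `K` containing a primitive `e`-th root of unity, and `α ∈ K*`. The
twisted group algebra `K^α C ≅ K[x]/(x^e − α)`. Let `d` be the largest divisor
of `e` such that `α` has a `d`-th root in `K`, and `e = c·d`. Then
`K[x]/(x^e − α)` is a product of exactly `d` fields, each of the form
`K[y]/(y^c − β)` with `y^c − β` irreducible; in particular the number of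
primitive idempotents equals `d`. -/
theorem twisted_cyclic_group_algebra_decomposition {K : Type*} [Field K]
    (e c d : ℕ) (he : e ≠ 0) (hecd : e = c * d)
    (hinv : (e : K) ≠ 0) (ζ : K) (hζ : IsPrimitiveRoot ζ e)
    (α : K) (hα : α ≠ 0)
    (hdd : d ∣ e) (hdroot : ∃ β : K, β ^ d = α)
    (hdmax : ∀ k : ℕ, k ∣ e → (∃ β : K, β ^ k = α) → k ≤ d) :
    ∃ β : Fin d → K,
      (∀ j, Irreducible ((X : K[X]) ^ c - C (β j))) ∧
      Nonempty ((K[X] ⧸ Ideal.span {(X : K[X]) ^ e - C α}) ≃ₐ[K]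
        ((j : Fin d) → K[X] ⧸ Ideal.span {(X : K[X]) ^ c - C (β j)})) ∧
      Nat.card {x : K[X] ⧸ Ideal.span {(X : K[X]) ^ e - C α} //
        x * x = x ∧ x ≠ 0 ∧
        ∀ a b : K[X] ⧸ Ideal.span {(X : K[X]) ^ e - C α},
          a * a = a → b * b = b → a * b = 0 → b * a = 0 → x = a + b →
            a = 0 ∨ b = 0} = d := by
  have hd : 0 < d := Nat.pos_of_ne_zero (right_ne_zero_of_mul (hecd ▸ he))
  have hc : c ≠ 0 := left_ne_zero_of_mul (hecd ▸ he)
  have hepos := Nat.pos_of_ne_zero he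
  obtain ⟨b, hb⟩ := hdroot
  have hω : IsPrimitiveRoot (ζ ^ c) d := hζ.pow hepos hecd
  have hη : IsPrimitiveRoot (ζ ^ d) c := hζ.pow hepos (hecd.trans (mul_comm c d))
  have hb0 : b ≠ 0 := by
    rintro rfl
    exact hα (by rw [← hb, zero_pow hd.ne'])
  have hpow (j : ℕ) : ((ζ ^ c) ^ j * b) ^ d = α := by
    rw [mul_pow, hb, pow_right_comm, hω.pow_eq_one, one_pow, one_mul]
  have hirr (j : Fin d) : Irreducible ((X : K[X]) ^ c - C ((ζ ^ c) ^ (j : ℕ) * b)) := by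
    refine X_pow_sub_C_irreducible_of_isPrimitiveRoot hc hη
      (mul_ne_zero (pow_ne_zero _ (hω.ne_zero hd.ne')) hb0) fun p hp hpc y hy ↦ ?_
    have hle := hdmax (p * d) (hecd ▸ Nat.mul_dvd_mul_right hpc d)
      ⟨y, by rw [pow_mul, hy, hpow]⟩
    nlinarith [hp.two_le]
  have hcop : Pairwise fun i j : Fin d ↦ IsCoprime
      ((X : K[X]) ^ c - C ((ζ ^ c) ^ (i : ℕ) * b)) (X ^ c - C ((ζ ^ c) ^ (j : ℕ) * b)) :=
    fun i j hij ↦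
    isCoprime_X_pow_sub_C c fun h ↦
      hij (Fin.ext (hω.pow_inj i.isLt j.isLt (mul_right_cancel₀ hb0 h)))
  obtain ⟨φ⟩ := nonempty_quotient_span_prod_algEquiv_pi K _ hcop
  rw [← X_pow_mul_sub_C_eq_prod hd hω hb, ← hecd] at φ
  refine ⟨fun j ↦ (ζ ^ c) ^ (j : ℕ) * b, hirr, ⟨φ⟩, ?_⟩
  have (j : Fin d) :
      IsDomain (K[X] ⧸ Ideal.span {(X : K[X]) ^ c - C ((ζ ^ c) ^ (j : ℕ) * b)}) :=
    (Ideal.Quotient.isDomain_iff_prime _).mpr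
      ((Ideal.span_singleton_prime (hirr j).ne_zero).mpr (hirr j).prime)
  exact (card_isPrimitiveIdempotent_of_ringEquiv_pi φ.toRingEquiv).trans (Nat.card_fin d)
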